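/- arXiv:1804.08779 — 5 statements merged into one kernel-verified Lean document; each statement's English description precedes it below -/
import Mathlib

section
/- Let s ∈ ℝ ∖ ℤ and u ∈ ℝ with u > 0. Then, with q ranging over real numbers in (0,1), lim_{q→0⁺} ϑ_q(u · q^{−s/2}) / ϑ_q(q^{−s/2}) = u^{2⌊s⌋+1}, where ⌊s⌋ denotes the integer part of s. (In the paper's variables x = u², z = q^{−s}, this is the K-theoretic slope limit lim_{q→0} ϑ(xz)/ϑ(z) = x^{⌊s⌋+1/2}, which produces the locally constant dependence of the K-theoretic stable envelope on the slope.) -/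
/-- The real theta function `ϑ_q(u) = (u − u⁻¹) · ∏_{i≥1} (1 − u² qⁱ) · ∏_{i≥1} (1 − u⁻² qⁱ)`,
written in the square-root variable `u` (so `x = u²` in the paper's notation). -/
noncomputable def ellThetaR (q u : ℝ) : ℝ :=
  (u - u⁻¹) * (∏' i : ℕ, (1 - u ^ 2 * q ^ (i + 1))) *
    (∏' i : ℕ, (1 - (u⁻¹) ^ 2 * q ^ (i + 1)))

open Filter Topology in
/-- A positive real power of `q` tends to `0` as `q → 0` inside `(0, 1)`. -/
theorem tendsto_rpow_nhdsWithin_Ioo {d : ℝ} (hd : 0 < d) :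
    Tendsto (fun q : ℝ => q ^ d) (𝓝[Set.Ioo 0 1] 0) (𝓝 0) := by
  have h := (Real.continuousAt_rpow_const 0 d (Or.inr hd.le)).tendsto
  rw [Real.zero_rpow hd.ne'] at h
  exact h.mono_left nhdsWithin_le_nhds

open Filter Topology in
/-- The infinite product `∏ (1 - a q^d qⁱ)` tends to `1` as `q → 0⁺` when `d > 0`. -/
theorem tendsto_tprod_one_sub_rpow (a : ℝ) {d : ℝ} (hd : 0 < d) :
    Tendsto (fun q : ℝ => ∏' i : ℕ, (1 + -(a * q ^ d * q ^ i))) (𝓝[Set.Ioo 0 1] 0) (𝓝 1) := by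
  have hq : ∀ᶠ q : ℝ in 𝓝[Set.Ioo 0 1] 0, q < 1 / 2 :=
    nhdsWithin_le_nhds (gt_mem_nhds (by norm_num))
  have key := tendsto_tprod_one_add_of_dominated_convergence
    (𝓕 := 𝓝[Set.Ioo (0 : ℝ) 1] 0) (f := fun (q : ℝ) (i : ℕ) => -(a * q ^ d * q ^ i))
    (g := fun _ => 0) (bound := fun i : ℕ => |a| * (1 / 2 : ℝ) ^ i)
    ((summable_geometric_of_lt_one (by norm_num) (by norm_num)).mul_left _) ?_ ?_
  · simpa using key
  · intro i
    have h1 : Tendsto (fun q : ℝ => q ^ i) (𝓝[Set.Ioo 0 1] 0) (𝓝 (0 ^ i)) :=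
      ((continuous_pow i).tendsto 0).mono_left nhdsWithin_le_nhds
    simpa using (((tendsto_rpow_nhdsWithin_Ioo hd).const_mul a).mul h1).neg
  · filter_upwards [hq, self_mem_nhdsWithin] with q hq hq' i
    have h0 : 0 ≤ q := hq'.1.le
    have h1 : q ^ d ≤ 1 := Real.rpow_le_one h0 hq'.2.le hd.le
    rw [norm_neg, norm_mul, norm_mul, Real.norm_eq_abs, Real.norm_of_nonneg (by positivity),
      Real.norm_of_nonneg (by positivity)]
    calc |a| * q ^ d * q ^ i ≤ |a| * 1 * (1 / 2) ^ i := by gcongr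
      _ = _ := by ring

open Filter Topology in
/-- If `t → ∞`, expressed through `t⁻¹ → 0`, then `(1 - a t) / (1 - t) → a`. -/
theorem tendsto_one_sub_mul_div_one_sub {α : Type*} {l : Filter α} {t : α → ℝ} (a : ℝ)
    (ht0 : ∀ᶠ x in l, t x ≠ 0) (ht : Tendsto (fun x => (t x)⁻¹) l (𝓝 0)) :
    Tendsto (fun x => (1 - a * t x) / (1 - t x)) l (𝓝 a) := by
  have h : Tendsto (fun x => ((t x)⁻¹ - a) / ((t x)⁻¹ - 1)) l (𝓝 ((0 - a) / (0 - 1))) :=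
    (ht.sub_const a).div (ht.sub_const 1) (by norm_num)
  rw [show (0 - a) / (0 - 1) = a by ring] at h
  refine h.congr' ?_
  filter_upwards [ht0] with x hx
  rw [← mul_div_mul_left ((t x)⁻¹ - a) _ hx, mul_sub, mul_sub, mul_inv_cancel₀ hx, mul_one,
    mul_comm (t x) a]

/-- Splitting the first `n` factors off the product `∏ (1 - a q^{-s} q^{i+1})`. -/
theorem tprod_one_sub_rpow_split (a s : ℝ) (n : ℕ) {q : ℝ} (hq : q ∈ Set.Ioo (0 : ℝ) 1) :
    ∏' i : ℕ, (1 - a * q ^ (-s) * q ^ (i + 1)) =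
      (∏ i ∈ Finset.range n, (1 - a * (q ^ (-s) * q ^ (i + 1)))) *
        ∏' i : ℕ, (1 + -(a * q ^ ((n : ℝ) + 1 - s) * q ^ i)) := by
  have hexp : q ^ ((n : ℝ) + 1 - s) = q ^ (-s) * q ^ (n + 1) := by
    rw [← Real.rpow_natCast, ← Real.rpow_add hq.1]
    push_cast
    ring_nf
  have htail : ∀ i : ℕ, 1 + -(a * q ^ ((n : ℝ) + 1 - s) * q ^ i) =
      1 - a * q ^ (-s) * q ^ (i + n + 1) := by
    intro i
    rw [hexp]
    ring
  have hm : Multipliable fun i : ℕ => 1 - a * q ^ (-s) * q ^ (i + n + 1) := by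
    simp_rw [← htail]
    refine multipliable_one_add_of_summable ?_
    exact (((summable_geometric_of_lt_one hq.1.le hq.2).mul_left _).neg).norm
  simp_rw [htail, ← mul_assoc]
  exact (Multipliable.prod_mul_tprod_nat_mul'
    (f := fun i : ℕ => 1 - a * q ^ (-s) * q ^ (i + 1)) hm).symm

open Filter Topology in
/-- Only the factors with `i + 1 < s` contribute to the limit of the quotient of products. -/
theorem tendsto_tprod_div_tprod (a s : ℝ) (hs : ∀ m : ℤ, s ≠ m) :
    Tendsto (fun q : ℝ => (∏' i : ℕ, (1 - a * q ^ (-s) * q ^ (i + 1))) /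
        ∏' i : ℕ, (1 - q ^ (-s) * q ^ (i + 1)))
      (𝓝[Set.Ioo 0 1] 0) (𝓝 (a ^ ⌊s⌋.toNat)) := by
  set n := ⌊s⌋.toNat with hn
  have hd : 0 < (n : ℝ) + 1 - s := by
    have h1 := Int.lt_floor_add_one s
    have h2 : (⌊s⌋ : ℝ) ≤ n := by exact_mod_cast Int.self_le_toNat ⌊s⌋
    linarith
  have htail := (tendsto_tprod_one_sub_rpow a hd).div (tendsto_tprod_one_sub_rpow 1 hd) one_ne_zero
  have hfin : Tendsto (fun q : ℝ => ∏ i ∈ Finset.range n,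
      ((1 - a * (q ^ (-s) * q ^ (i + 1))) / (1 - q ^ (-s) * q ^ (i + 1))))
      (𝓝[Set.Ioo 0 1] 0) (𝓝 (∏ _i ∈ Finset.range n, a)) := by
    refine tendsto_finsetProd _ fun i hi => tendsto_one_sub_mul_div_one_sub a ?_ ?_
    · filter_upwards [self_mem_nhdsWithin] with q hq
      have := hq.1
      positivity
    · have hlt : 0 < s - (i + 1 : ℕ) := by
        have h1 : ((i + 1 : ℕ) : ℤ) ≤ ⌊s⌋ := by
          have := Finset.mem_range.1 hi
          omega
        have h2 := lt_of_le_of_ne (Int.le_floor.1 h1) (hs _).symm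
        push_cast at h2 ⊢
        linarith
      refine (tendsto_rpow_nhdsWithin_Ioo hlt).congr' ?_
      filter_upwards [self_mem_nhdsWithin] with q hq
      rw [← Real.rpow_natCast q (i + 1), ← Real.rpow_add hq.1, ← Real.rpow_neg hq.1.le]
      ring_nf
  have h := hfin.mul htail
  rw [Finset.prod_const, Finset.card_range, div_one, mul_one] at h
  refine h.congr' ?_
  filter_upwards [self_mem_nhdsWithin] with q hq
  have h1 := tprod_one_sub_rpow_split 1 s n hq
  simp only [one_mul] at h1
  simp only [Pi.div_apply, one_mul]
  rw [tprod_one_sub_rpow_split a s n hq, h1, Finset.prod_div_distrib, div_mul_div_comm]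

open Filter Topology in
/-- The limit of the quotient of the prefactors `v - v⁻¹`, for negative exponent `-r` of `q`. -/
theorem tendsto_sub_inv_div_sub_inv {u r : ℝ} (hu : 0 < u) (hr : 0 < r) :
    Tendsto (fun q : ℝ => (u * q ^ (-r) - (u * q ^ (-r))⁻¹) / (q ^ (-r) - (q ^ (-r))⁻¹))
      (𝓝[Set.Ioo 0 1] 0) (𝓝 u) := by
  have h0 := tendsto_rpow_nhdsWithin_Ioo hr
  have h : Tendsto (fun q : ℝ => (u - u⁻¹ * (q ^ r * q ^ r)) / (1 - q ^ r * q ^ r))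
      (𝓝[Set.Ioo 0 1] 0) (𝓝 ((u - u⁻¹ * (0 * 0)) / (1 - 0 * 0))) :=
    (((h0.mul h0).const_mul u⁻¹).const_sub u).div ((h0.mul h0).const_sub 1) (by norm_num)
  rw [show (u - u⁻¹ * (0 * 0)) / (1 - 0 * 0) = u by simp] at h
  refine h.congr' ?_
  filter_upwards [self_mem_nhdsWithin] with q hq
  have hp : q ^ r ≠ 0 := (Real.rpow_pos_of_pos hq.1 r).ne'
  rw [Real.rpow_neg hq.1.le, ← mul_div_mul_left (u * (q ^ r)⁻¹ - _) _ hp]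
  congr 1 <;> field_simp

/-- The K-theoretic slope limit: for a non-integral slope `s` and `u > 0`, as `q → 0⁺` in `(0,1)`,
`ϑ_q(u·q^{−s/2}) / ϑ_q(q^{−s/2}) → u^{2⌊s⌋+1}`, i.e. `lim_{q→0} ϑ(xz)/ϑ(z) = x^{⌊s⌋+1/2}`
in the paper's variables `x = u²`, `z = q^{−s}`. -/
theorem ellThetaR_slope_limit (s : ℝ) (hs : ∀ m : ℤ, s ≠ (m : ℝ))
    (u : ℝ) (hu : 0 < u) :
    Filter.Tendsto
      (fun q : ℝ => ellThetaR q (u * q ^ (-s / 2)) / ellThetaR q (q ^ (-s / 2)))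
      (nhdsWithin 0 (Set.Ioo 0 1))
      (nhds (u ^ (2 * ⌊s⌋ + 1))) := by
  have hneg : ∀ m : ℤ, -s ≠ m := fun m hm => hs (-m) (by push_cast; linarith)
  have hs0 : s ≠ 0 := by simpa using hs 0
  have hfloor : ⌊-s⌋ = -⌊s⌋ - 1 := by
    rw [Int.floor_eq_iff]
    have h1 := lt_of_le_of_ne (Int.floor_le s) (hs _).symm
    have h2 := Int.lt_floor_add_one s
    push_cast
    constructor <;> linarith
  have hpre : Filter.Tendsto (fun q : ℝ => (u * q ^ (-s / 2) - (u * q ^ (-s / 2))⁻¹) /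
      (q ^ (-s / 2) - (q ^ (-s / 2))⁻¹)) (nhdsWithin 0 (Set.Ioo 0 1))
      (nhds (if 0 < s then u else u⁻¹)) := by
    split_ifs with h
    · simpa only [neg_div] using tendsto_sub_inv_div_sub_inv hu (half_pos h)
    · have hlt : 0 < -s / 2 := by
        have := lt_of_le_of_ne (not_lt.1 h) hs0
        linarith
      refine (tendsto_sub_inv_div_sub_inv (inv_pos.2 hu) hlt).congr' ?_
      filter_upwards [self_mem_nhdsWithin] with q hq
      rw [Real.rpow_neg hq.1.le, ← mul_inv, inv_inv, inv_inv, ← neg_sub, ← neg_sub (q ^ (-s / 2)),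
        neg_div_neg_eq]
  have h := (hpre.mul (tendsto_tprod_div_tprod (u ^ 2) s hs)).mul
    (tendsto_tprod_div_tprod (u⁻¹ ^ 2) (-s) hneg)
  have hlim : (if 0 < s then u else u⁻¹) * (u ^ 2) ^ ⌊s⌋.toNat * (u⁻¹ ^ 2) ^ ⌊-s⌋.toNat =
      u ^ (2 * ⌊s⌋ + 1) := by
    rw [hfloor]
    split_ifs with h
    · obtain ⟨n, hn⟩ := Int.eq_ofNat_of_zero_le (Int.floor_nonneg.2 h.le)
      have h2 : (-(n : ℤ) - 1).toNat = 0 := by omega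
      rw [hn, h2, Int.toNat_natCast, pow_zero, mul_one, ← pow_mul, ← pow_succ', ← zpow_natCast]
      push_cast
      rfl
    · have hlt : ⌊s⌋ < 0 := Int.floor_lt.2 (by
        simpa using lt_of_le_of_ne (not_lt.1 h) hs0)
      obtain ⟨n, hn⟩ := Int.eq_ofNat_of_zero_le (show 0 ≤ -⌊s⌋ - 1 by omega)
      rw [hn, Int.toNat_of_nonpos hlt.le, Int.toNat_natCast, pow_zero, mul_one, ← pow_mul,
        ← pow_succ', inv_pow, ← zpow_natCast, ← zpow_neg]
      congr 1
      push_cast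
      omega
  rw [hlim] at h
  refine h.congr' ?_
  filter_upwards [self_mem_nhdsWithin] with q hq
  have hsq : (q ^ (-s / 2)) ^ 2 = q ^ (-s) := by
    rw [← Real.rpow_natCast, ← Real.rpow_mul hq.1.le]
    congr 1
    push_cast
    ring
  have hsq' : ((q ^ (-s / 2))⁻¹) ^ 2 = q ^ (- -s) := by
    rw [inv_pow, hsq, Real.rpow_neg hq.1.le (-s)]
  simp only [ellThetaR, mul_inv, mul_pow, hsq, hsq']
  rw [div_mul_div_comm, div_mul_div_comm]
end

section
/- Let λ be a Young diagram and let δ be a choice, for every box (i,j) ∈ λ with (i+1,j+1) ∈ λ, of one of the two edges {(i,j),(i+1,j)} and {(i+1,j),(i+1,j+1)} of Γ_λ (i.e. δ ∈ Υ_λ). Then the graph t_δ obtained from Γ_λ by deleting all the chosen edges is a spanning tree of the set of boxes of λ: it is connected and acyclic. In particular t_δ is a λ-tree, i.e. a tree with vertex set the boxes of λ, root (1,1), and edges connecting only adjacent boxes. -/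
/-- Two boxes are adjacent if they agree in one coordinate and differ by 1 in the other. -/
def adjBox (a b : ℕ × ℕ) : Prop :=
  (a.1 = b.1 ∧ (a.2 + 1 = b.2 ∨ b.2 + 1 = a.2)) ∨
    (a.2 = b.2 ∧ (a.1 + 1 = b.1 ∨ b.1 + 1 = a.1))

/-- The (symmetrized) relation on boxes saying that the unordered pair `{a, b}` is one of the
edges removed by the choice `δ ∈ Υ_λ`: for each box `(i,j) ∈ λ` with `(i+1,j+1) ∈ λ`
(an ⌐-shaped subgraph), if `δ (i,j) = true` we remove the edge `δ₁ = {(i,j),(i+1,j)}`,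
and if `δ (i,j) = false` we remove the edge `δ₂ = {(i+1,j),(i+1,j+1)}`. -/
def removedRel (μ : YoungDiagram) (δ : ℕ × ℕ → Bool) (a b : ℕ × ℕ) : Prop :=
  ∃ i j : ℕ, (i, j) ∈ μ.cells ∧ (i + 1, j + 1) ∈ μ.cells ∧
    ((δ (i, j) = true ∧
        ((a, b) = ((i, j), (i + 1, j)) ∨ (a, b) = ((i + 1, j), (i, j)))) ∨
      (δ (i, j) = false ∧
        ((a, b) = ((i + 1, j), (i + 1, j + 1)) ∨ (a, b) = ((i + 1, j + 1), (i + 1, j)))))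

/-- The graph `t_δ = Γ_λ ∖ δ` on the boxes of `λ`: edges join adjacent boxes,
with the edges chosen by `δ` deleted. -/
def treeGraph (μ : YoungDiagram) (δ : ℕ × ℕ → Bool) : SimpleGraph μ.cells :=
  SimpleGraph.fromRel fun a b =>
    adjBox a.val b.val ∧ ¬ removedRel μ δ a.val b.val

/-- A finite graph with a height function such that every vertex except the root has exactly one
strictly lower neighbour, and adjacent vertices have different heights, is a tree. -/
theorem SimpleGraph.isTree_of_unique_lower_neighbor {V : Type*} [Finite V] (G : SimpleGraph V)
    (r : V) (height : V → ℕ)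
    (ne_of_adj : ∀ v w, G.Adj v w → height v ≠ height w)
    (exists_lower : ∀ v, v ≠ r → ∃ w, G.Adj v w ∧ height w < height v)
    (lower_unique : ∀ v w w', G.Adj v w → G.Adj v w' → height w < height v →
      height w' < height v → w = w')
    (root_lowest : ∀ w, G.Adj r w → height r < height w) : G.IsTree := by
  have reachable_root : ∀ n v, height v = n → G.Reachable v r := by
    intro n
    induction n using Nat.strong_induction_on with
    | _ n ih =>
      rintro v rfl
      by_cases hv : v = r
      · rw [hv]
      · obtain ⟨w, hvw, hlt⟩ := exists_lower v hv
        exact hvw.reachable.trans (ih _ hlt w rfl)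
  have hconn : G.Connected :=
    { preconnected := fun v w => (reachable_root _ v rfl).trans (reachable_root _ w rfl).symm
      nonempty := ⟨r⟩ }
  rw [SimpleGraph.isTree_iff_connected_and_card]
  refine ⟨hconn, le_antisymm ?_ hconn.card_vert_le_card_edgeSet_add_one⟩
  choose! parent adj_parent parent_lower using exists_lower
  have hsub : G.edgeSet ⊆ (fun v => s(v, parent v)) '' {r}ᶜ := by
    have key : ∀ a b, G.Adj a b → height b < height a →
        s(a, b) ∈ (fun v => s(v, parent v)) '' {r}ᶜ := by
      intro a b hab hlt
      have ha : a ≠ r := by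
        rintro rfl
        exact (root_lowest b hab).not_gt hlt
      refine ⟨a, ha, ?_⟩
      rw [lower_unique a _ _ hab (adj_parent a ha) hlt (parent_lower a ha)]
    intro e
    induction e using Sym2.ind with
    | _ a b =>
      intro hab
      rw [SimpleGraph.mem_edgeSet] at hab
      rcases (ne_of_adj a b hab).lt_or_gt with hlt | hlt
      · rw [Sym2.eq_swap]
        exact key b a hab.symm hlt
      · exact key a b hab hlt
  have hcard := (Set.ncard_le_ncard hsub (Set.toFinite _)).trans
    (Set.ncard_image_le (Set.toFinite _))
  have hcompl := Set.ncard_add_ncard_compl ({r} : Set V)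
  rw [Set.ncard_singleton] at hcompl
  rw [Nat.card_coe_set_eq]
  omega

theorem adjBox_comm {a b : ℕ × ℕ} : adjBox a b ↔ adjBox b a := by
  unfold adjBox
  omega

theorem removedRel_comm {μ : YoungDiagram} {δ : ℕ × ℕ → Bool} {a b : ℕ × ℕ} :
    removedRel μ δ a b ↔ removedRel μ δ b a := by
  unfold removedRel
  grind

theorem treeGraph_adj {μ : YoungDiagram} {δ : ℕ × ℕ → Bool} {a b : μ.cells} :
    (treeGraph μ δ).Adj a b ↔ adjBox a.val b.val ∧ ¬ removedRel μ δ a.val b.val := by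
  rw [treeGraph, SimpleGraph.fromRel_adj, adjBox_comm (a := b.val),
    removedRel_comm (a := b.val), or_self, and_iff_right_iff_imp]
  rintro ⟨h, -⟩ rfl
  unfold adjBox at h
  omega

theorem removedRel_vertical {μ : YoungDiagram} {δ : ℕ × ℕ → Bool} {i j : ℕ} :
    removedRel μ δ (i + 1, j) (i, j) ↔ (i + 1, j + 1) ∈ μ ∧ δ (i, j) = true := by
  constructor
  · rintro ⟨i', j', -, h, h'⟩
    grind [YoungDiagram.mem_cells]
  · rintro ⟨h, h'⟩
    exact ⟨i, j, μ.up_left_mem (by omega) (by omega) h, h, Or.inl ⟨h', Or.inr rfl⟩⟩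

theorem removedRel_horizontal {μ : YoungDiagram} {δ : ℕ × ℕ → Bool} {i j : ℕ} :
    removedRel μ δ (i, j) (i, j + 1) ↔
      ∃ k, i = k + 1 ∧ (i, j + 1) ∈ μ ∧ δ (k, j) = false := by
  constructor
  · rintro ⟨i', j', -, h, h'⟩
    grind [YoungDiagram.mem_cells]
  · rintro ⟨k, rfl, h, hδ⟩
    exact ⟨k, j, μ.up_left_mem (by omega) (by omega) h, h, Or.inr ⟨hδ, Or.inl rfl⟩⟩

/-- For every choice `δ ∈ Υ_λ` of one edge from each ⌐-shaped subgraph of `Γ_λ`,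
the graph `t_δ = Γ_λ ∖ δ` is a spanning tree of the boxes of `λ`:
it is connected and acyclic, hence a `λ`-tree. -/
theorem treeGraph_isTree (μ : YoungDiagram) (hne : μ.cells.Nonempty)
    (δ : ℕ × ℕ → Bool) : (treeGraph μ δ).IsTree := by
  have col_lt : ∀ {i j : ℕ}, (i, j) ∈ μ → j < μ.rowLen 0 := fun h =>
    YoungDiagram.mem_iff_lt_rowLen.mp (μ.up_left_mem (Nat.zero_le _) le_rfl h)
  have hpos : 0 < μ.rowLen 0 := by
    obtain ⟨⟨i, j⟩, h⟩ := hne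
    exact (Nat.zero_le _).trans_lt (col_lt h)
  have hroot : (0, μ.rowLen 0 - 1) ∈ μ.cells :=
    YoungDiagram.mem_iff_lt_rowLen.mpr (by omega)
  -- Lower neighbours lie directly above or directly to the right.
  have lower_iff : ∀ {i j k l : ℕ} (h : (i, j) ∈ μ.cells) (h' : (k, l) ∈ μ.cells),
      ((treeGraph μ δ).Adj ⟨(i, j), h⟩ ⟨(k, l), h'⟩ ∧
        k + (μ.rowLen 0 - l) < i + (μ.rowLen 0 - j)) ↔
      (i = k + 1 ∧ l = j ∧ ¬ ((i, j + 1) ∈ μ ∧ δ (k, j) = true)) ∨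
      (k = i ∧ l = j + 1 ∧ ¬ ∃ m, i = m + 1 ∧ δ (m, j) = false) := by
    intro i j k l h h'
    have hj := col_lt h
    have hl := col_lt h'
    rw [treeGraph_adj]
    constructor
    · rintro ⟨⟨hadj, hrem⟩, hlt⟩
      have hcases : (i = k + 1 ∧ l = j) ∨ (k = i ∧ l = j + 1) := by
        unfold adjBox at hadj
        dsimp only at hadj
        omega
      rcases hcases with ⟨rfl, rfl⟩ | ⟨rfl, rfl⟩
      · exact Or.inl ⟨rfl, rfl, fun hn => hrem (removedRel_vertical.mpr hn)⟩
      · refine Or.inr ⟨rfl, rfl, ?_⟩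
        rintro ⟨m, hm, hδ⟩
        exact hrem (removedRel_horizontal.mpr ⟨m, hm, h', hδ⟩)
    · rintro (⟨rfl, rfl, hn⟩ | ⟨rfl, rfl, hn⟩)
      · refine ⟨⟨Or.inr ⟨rfl, Or.inr rfl⟩, fun hr => hn (removedRel_vertical.mp hr)⟩, by omega⟩
      · refine ⟨⟨Or.inl ⟨rfl, Or.inl rfl⟩, fun hr => hn ?_⟩, by omega⟩
        obtain ⟨m, hm, -, hδ⟩ := removedRel_horizontal.mp hr
        exact ⟨m, hm, hδ⟩
  have ne_of_adj : ∀ v w : μ.cells, (treeGraph μ δ).Adj v w →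
      v.val.1 + (μ.rowLen 0 - v.val.2) ≠ w.val.1 + (μ.rowLen 0 - w.val.2) := by
    rintro ⟨⟨i, j⟩, h⟩ ⟨⟨k, l⟩, h'⟩ hadj
    have hj := col_lt h
    have hl := col_lt h'
    have hbox := (treeGraph_adj.mp hadj).1
    unfold adjBox at hbox
    dsimp only at hbox ⊢
    omega
  refine SimpleGraph.isTree_of_unique_lower_neighbor _ ⟨_, hroot⟩
    (fun v => v.val.1 + (μ.rowLen 0 - v.val.2)) ne_of_adj ?_ ?_ ?_
  · rintro ⟨⟨i, j⟩, h⟩ hv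
    by_cases hright : (i, j + 1) ∈ μ ∧ ¬ ∃ m, i = m + 1 ∧ δ (m, j) = false
    · exact ⟨⟨(i, j + 1), hright.1⟩, (lower_iff h hright.1).mpr (Or.inr ⟨rfl, rfl, hright.2⟩)⟩
    · cases i with
      | zero =>
        have hj := col_lt h
        have hlast : ¬ j + 1 < μ.rowLen 0 := fun hlt =>
          hright ⟨YoungDiagram.mem_iff_lt_rowLen.mpr hlt, by simp⟩
        refine absurd ?_ hv
        simp only [Subtype.mk.injEq, Prod.mk.injEq, true_and]
        omega
      | succ k =>
        have hup : (k, j) ∈ μ.cells := μ.up_left_mem (Nat.le_succ k) le_rfl h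
        refine ⟨⟨(k, j), hup⟩, (lower_iff h hup).mpr (Or.inl ⟨rfl, rfl, ?_⟩)⟩
        rintro ⟨hmem, hδ⟩
        refine hright ⟨hmem, ?_⟩
        rintro ⟨m, hm, hδ'⟩
        obtain rfl : k = m := by omega
        simp [hδ] at hδ'
  · rintro ⟨⟨i, j⟩, h⟩ ⟨⟨k, l⟩, h'⟩ ⟨⟨k', l'⟩, h''⟩ hadj hadj' hlt hlt'
    have h₁ := (lower_iff h h').mp ⟨hadj, hlt⟩
    have h₂ := (lower_iff h h'').mp ⟨hadj', hlt'⟩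
    rw [YoungDiagram.mem_cells] at h' h''
    grind
  · rintro ⟨⟨k, l⟩, h'⟩ hadj
    refine lt_of_le_of_ne (not_lt.mp fun hlt => ?_) (ne_of_adj _ _ hadj)
    have hl := col_lt h'
    rcases (lower_iff hroot h').mp ⟨hadj, hlt⟩ with h | h <;> omega
end

section
/- Let λ be a Young diagram and σ : λ → λ a bijection of its boxes with c_{σ(b)} = c_b for every box b (a content-preserving permutation, σ ∈ 𝔖_λ). Suppose: (i) for every box b with c_b = 0 and h_b > 0, σ(b) ≠ (1,1); (ii) for all boxes b, b' with c_{b'} = c_b + 1 and h_b ≥ h_{b'} + 3, one has h_{σ(b)} ≠ h_{σ(b')} + 1; (iii) for all boxes b, b' with c_{b'} = c_b + 1 and h_{b'} ≥ h_b + 3, one has h_{σ(b')} ≠ h_{σ(b)} + 1. Then σ is the identity. (This is Proposition 7.1: if N^σ_λ(φ^λ_1,…,φ^λ_n) ≠ 0 then σ = 1; conditions (i)–(iii) say exactly that no theta factor of N^σ_λ vanishes at the fixed-point substitution x_b = φ^λ_b = a^{c_b} ℏ^{−h_b/2}.) -/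
/-- Content of a box (0-based Mathlib coordinates; agrees with the paper's `c = i − j`). -/
def boxContent (b : ℕ × ℕ) : ℤ := (b.1 : ℤ) - b.2

/-- Height of a box (0-based Mathlib coordinates; the paper's `h = i + j − 2` for 1-based
coordinates is `i + j` in 0-based ones, so differences and comparisons agree). -/
def boxHeight (b : ℕ × ℕ) : ℕ := b.1 + b.2

theorem eq_of_boxContent_eq_of_boxHeight_eq {b b' : ℕ × ℕ}
    (hc : boxContent b = boxContent b') (hh : boxHeight b = boxHeight b') : b = b' := by
  unfold boxContent at hc
  unfold boxHeight at hh
  ext <;> omega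

/-- Boxes of adjacent contents have heights of opposite parity. -/
theorem boxHeight_add_three_le {b b' : ℕ × ℕ}
    (hc : boxContent b' = boxContent b + 1 ∨ boxContent b = boxContent b' + 1)
    (hh : boxHeight b + 1 < boxHeight b') : boxHeight b + 3 ≤ boxHeight b' := by
  unfold boxContent at hc
  unfold boxHeight at hh ⊢
  omega

/-- A content-preserving permutation that does not raise the height of any box is the identity. -/
theorem eq_refl_of_boxHeight_le {s : Finset (ℕ × ℕ)} (τ : Equiv.Perm s)
    (hc : ∀ b, boxContent (τ b).val = boxContent b.val)
    (hh : ∀ b, boxHeight (τ b).val ≤ boxHeight b.val) : τ = Equiv.refl _ := by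
  have hsum : ∑ b, boxHeight (τ b).val = ∑ b : s, boxHeight b.val :=
    Equiv.sum_comp τ fun b : s => boxHeight b.val
  have heq := (Finset.sum_eq_sum_iff_of_le fun b _ => hh b).1 hsum
  ext1 b
  exact Subtype.ext (eq_of_boxContent_eq_of_boxHeight_eq (hc b) (heq b (Finset.mem_univ b)))

/-- Proposition 7.1: a content-preserving permutation `σ ∈ 𝔖_λ` of the boxes of a Young
diagram such that (i) no box of content 0 and positive height goes to the corner box,
(ii), (iii) no pair of boxes of adjacent contents at height distance ≥ 3 is mapped to a
pair at height distance 1, must be the identity. -/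
theorem content_preserving_perm_eq_one (μ : YoungDiagram)
    (σ : Equiv.Perm μ.cells)
    (hc : ∀ b, boxContent (σ b).val = boxContent b.val)
    (h1 : ∀ b : μ.cells, boxContent b.val = 0 → 0 < boxHeight b.val →
      (σ b).val ≠ (0, 0))
    (h2 : ∀ b b' : μ.cells, boxContent b'.val = boxContent b.val + 1 →
      boxHeight b'.val + 3 ≤ boxHeight b.val →
      boxHeight (σ b).val ≠ boxHeight (σ b').val + 1)
    (h3 : ∀ b b' : μ.cells, boxContent b'.val = boxContent b.val + 1 →
      boxHeight b.val + 3 ≤ boxHeight b'.val →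
      boxHeight (σ b').val ≠ boxHeight (σ b).val + 1) :
    σ = Equiv.refl _ := by
  have hc' : ∀ b, boxContent (σ.symm b).val = boxContent b.val := fun b => by
    rw [← hc, σ.apply_symm_apply]
  have key : ∀ i j (hb : (i, j) ∈ μ.cells),
      boxHeight (σ.symm ⟨(i, j), hb⟩).val ≤ i + j := by
    intro i
    induction i with
    | zero =>
      intro j
      induction j with
      | zero =>
        intro hb
        by_contra! hlt
        refine h1 _ ?_ hlt (by rw [σ.apply_symm_apply])
        rw [hc']
        simp [boxContent]
      | succ j ih =>
        intro hb
        have hp : (0, j) ∈ μ.cells := μ.up_left_mem le_rfl j.le_succ hb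
        have hcon : boxContent (σ.symm ⟨(0, j), hp⟩).val =
            boxContent (σ.symm ⟨(0, j + 1), hb⟩).val + 1 := by
          rw [hc', hc']
          simp only [boxContent]
          push_cast
          ring
        by_contra! hlt
        have hle := ih hp
        refine h2 _ _ hcon (boxHeight_add_three_le (.inr hcon) (by omega)) ?_
        simp only [σ.apply_symm_apply, boxHeight]
        omega
    | succ i ih =>
      intro j hb
      have hp : (i, j) ∈ μ.cells := μ.up_left_mem i.le_succ le_rfl hb
      have hcon : boxContent (σ.symm ⟨(i + 1, j), hb⟩).val =
          boxContent (σ.symm ⟨(i, j), hp⟩).val + 1 := by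
        rw [hc', hc']
        simp only [boxContent]
        push_cast
        ring
      by_contra! hlt
      have hle := ih j hp
      refine h3 _ _ hcon (boxHeight_add_three_le (.inl hcon) (by omega)) ?_
      simp only [σ.apply_symm_apply, boxHeight]
      omega
  have hτ : σ.symm = Equiv.refl _ :=
    eq_refl_of_boxHeight_le σ.symm hc' fun b => key b.val.1 b.val.2 b.property
  rw [← σ.symm_symm, hτ, Equiv.refl_symm]
end

section
/- Let λ be a Young diagram and σ : λ → λ a content-preserving bijection of its boxes with σ ≠ id. Define V_N(σ) = #{ordered pairs (b,b') : c_{b'} = c_b + 1, h_b ≥ h_{b'} + 3, h_{σ(b)} = h_{σ(b')} + 1} + #{ordered pairs (b,b') : c_{b'} = c_b + 1, h_{b'} ≥ h_b + 3, h_{σ(b')} = h_{σ(b)} + 1} + #{b : c_b = 0, h_b > 0, σ(b) = (1,1)}, and V_D(σ) = #{ordered pairs (b,b') : c_b = c_{b'}, h_b > h_{b'} + 2, h_{σ(b)} = h_{σ(b')} + 2}. Then V_N(σ) ≥ V_D(σ) + 1. (This is Proposition 7.2: if D^σ_λ has V_D vanishing theta factors at the substitution x_b = φ^λ_b, then N^σ_λ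 has at least V_D + 1 vanishing factors.) -/
theorem box_ext_of_content_height {x y : ℕ × ℕ} (h₁ : boxContent x = boxContent y)
    (h₂ : boxHeight x = boxHeight y) : x = y := by
  unfold boxContent at h₁
  unfold boxHeight at h₂
  ext <;> omega

theorem boxHeight_parity {x y : ℕ × ℕ} (h : boxContent y = boxContent x + 1) :
    (boxHeight x + boxHeight y) % 2 = 1 := by
  unfold boxContent at h
  unfold boxHeight
  omega

/-- A content-preserving permutation is the identity as soon as no edge of the diagram, and not
the corner box either, contributes to the numerator count. -/
theorem eq_refl_of_no_jump (μ : YoungDiagram) (σ : Equiv.Perm μ.cells)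
    (hc : ∀ b, boxContent (σ b).val = boxContent b.val)
    (h₁ : ∀ p q : μ.cells, boxContent q.val = boxContent p.val + 1 →
      boxHeight q.val + 3 ≤ boxHeight p.val →
      boxHeight (σ p).val ≠ boxHeight (σ q).val + 1)
    (h₂ : ∀ p q : μ.cells, boxContent q.val = boxContent p.val + 1 →
      boxHeight p.val + 3 ≤ boxHeight q.val →
      boxHeight (σ q).val ≠ boxHeight (σ p).val + 1)
    (h₃ : ∀ b : μ.cells, boxContent b.val = 0 → 0 < boxHeight b.val → (σ b).val ≠ (0, 0)) :
    σ = Equiv.refl _ := by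
  have hle : ∀ n, ∀ b : μ.cells, boxHeight (σ b).val = n → boxHeight b.val ≤ n := by
    intro n
    induction n with
    | zero =>
      intro b hb
      by_contra! hpos
      have hz : (σ b).val = (0, 0) := by
        unfold boxHeight at hb
        ext <;> simp <;> omega
      have hcb := hc b
      rw [hz] at hcb
      exact h₃ b (by rw [← hcb]; rfl) hpos hz
    | succ n ih =>
      intro b hb
      obtain ⟨⟨i, j⟩, hx⟩ : ∃ x, x = (σ b).val := ⟨_, rfl⟩
      have hmem : (i, j) ∈ μ := by rw [hx]; exact (σ b).2
      have hcb := hc b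
      rw [← hx] at hb hcb
      by_cases hi : i = 0
      · have hj : 0 < j := by simp only [boxHeight] at hb; omega
        have hm : (i, j - 1) ∈ μ.cells := μ.up_left_mem le_rfl (Nat.sub_le _ _) hmem
        obtain ⟨y, hy⟩ := σ.surjective ⟨_, hm⟩
        have hcy := hc y
        have hy' : (σ y).val = (i, j - 1) := by rw [hy]
        have hhy : boxHeight (σ y).val = n := by
          rw [hy']; simp only [boxHeight] at hb ⊢; omega
        have hle := ih y hhy
        have hcc : boxContent y.val = boxContent b.val + 1 := by
          rw [← hcy, ← hcb, hy']; simp only [boxContent]; omega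
        have hpar := boxHeight_parity hcc
        have := h₁ b y hcc
        rw [hhy, ← hx, hb] at this
        by_contra! hlt
        exact this (by omega) rfl
      · have hm : (i - 1, j) ∈ μ.cells := μ.up_left_mem (Nat.sub_le _ _) le_rfl hmem
        obtain ⟨y, hy⟩ := σ.surjective ⟨_, hm⟩
        have hcy := hc y
        have hy' : (σ y).val = (i - 1, j) := by rw [hy]
        have hhy : boxHeight (σ y).val = n := by
          rw [hy']; simp only [boxHeight] at hb ⊢; omega
        have hle := ih y hhy
        have hcc : boxContent b.val = boxContent y.val + 1 := by
          rw [← hcy, ← hcb, hy']; simp only [boxContent]; omega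
        have hpar := boxHeight_parity hcc
        have := h₂ y b hcc
        rw [hhy, ← hx, hb] at this
        by_contra! hlt
        exact this (by omega) rfl
  have hsum : ∑ b : μ.cells, boxHeight b.val = ∑ b : μ.cells, boxHeight (σ b).val :=
    (Equiv.sum_comp σ fun b : μ.cells => boxHeight b.val).symm
  have heq := (Finset.sum_eq_sum_iff_of_le fun b _ => hle _ b rfl).1 hsum
  ext1 b
  exact Subtype.ext (box_ext_of_content_height (hc b) (heq b (Finset.mem_univ b)).symm)

/-- The two remaining corners of the unit square spanned by two boxes of the same content and
consecutive heights. -/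
theorem exists_square_corners (μ : YoungDiagram) (σ : Equiv.Perm μ.cells)
    (hc : ∀ b, boxContent (σ b).val = boxContent b.val) {p q : μ.cells}
    (hpq : boxContent p.val = boxContent q.val)
    (hh : boxHeight (σ p).val = boxHeight (σ q).val + 2) :
    (∃ r : μ.cells, boxContent p.val = boxContent r.val + 1 ∧
      boxHeight (σ r).val = boxHeight (σ q).val + 1) ∧
    ∃ s : μ.cells, boxContent s.val = boxContent p.val + 1 ∧
      boxHeight (σ s).val = boxHeight (σ q).val + 1 := by
  obtain ⟨⟨i, j⟩, hx⟩ : ∃ x, x = (σ p).val := ⟨_, rfl⟩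
  obtain ⟨⟨k, l⟩, hy⟩ : ∃ x, x = (σ q).val := ⟨_, rfl⟩
  have hmem : (i, j) ∈ μ := by rw [hx]; exact (σ p).2
  rw [← hc p, ← hc q, ← hx, ← hy] at hpq
  rw [← hx, ← hy] at hh
  simp only [boxContent, boxHeight] at hpq hh
  have hm₁ : (k, l + 1) ∈ μ.cells := μ.up_left_mem (by omega) (by omega) hmem
  have hm₂ : (k + 1, l) ∈ μ.cells := μ.up_left_mem (by omega) (by omega) hmem
  obtain ⟨r, hr⟩ := σ.surjective ⟨_, hm₁⟩
  obtain ⟨s, hs⟩ := σ.surjective ⟨_, hm₂⟩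
  refine ⟨⟨r, ?_, ?_⟩, ⟨s, ?_, ?_⟩⟩
  · rw [← hc p, ← hc r, hr, ← hx]; simp only [boxContent]; omega
  · rw [hr, ← hy]; simp only [boxHeight]; omega
  · rw [← hc p, ← hc s, hs, ← hx]; simp only [boxContent]; omega
  · rw [hs, ← hy]; simp only [boxHeight]; omega

/-- Proposition 7.2: for a non-identity content-preserving permutation `σ` of the boxes,
the number `V_N(σ)` of vanishing theta factors of the numerator `N^σ_λ` at the fixed-point
substitution is at least one more than the number `V_D(σ)` of vanishing factors of the
denominator `D^σ_λ`. -/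
theorem vanishing_factors_count (μ : YoungDiagram)
    (σ : Equiv.Perm μ.cells)
    (hc : ∀ b, boxContent (σ b).val = boxContent b.val)
    (hσ : σ ≠ Equiv.refl _) :
    (Finset.univ.filter fun p : μ.cells × μ.cells =>
        boxContent p.1.val = boxContent p.2.val ∧
          boxHeight p.2.val + 2 < boxHeight p.1.val ∧
          boxHeight (σ p.1).val = boxHeight (σ p.2).val + 2).card + 1 ≤
      (Finset.univ.filter fun p : μ.cells × μ.cells =>
        boxContent p.2.val = boxContent p.1.val + 1 ∧
          boxHeight p.2.val + 3 ≤ boxHeight p.1.val ∧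
          boxHeight (σ p.1).val = boxHeight (σ p.2).val + 1).card +
      (Finset.univ.filter fun p : μ.cells × μ.cells =>
        boxContent p.2.val = boxContent p.1.val + 1 ∧
          boxHeight p.1.val + 3 ≤ boxHeight p.2.val ∧
          boxHeight (σ p.2).val = boxHeight (σ p.1).val + 1).card +
      (Finset.univ.filter fun b : μ.cells =>
        boxContent b.val = 0 ∧ 0 < boxHeight b.val ∧ (σ b).val = (0, 0)).card := by
  classical
  set D := Finset.univ.filter fun p : μ.cells × μ.cells =>
        boxContent p.1.val = boxContent p.2.val ∧
          boxHeight p.2.val + 2 < boxHeight p.1.val ∧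
          boxHeight (σ p.1).val = boxHeight (σ p.2).val + 2 with hD
  set N₁ := Finset.univ.filter fun p : μ.cells × μ.cells =>
        boxContent p.2.val = boxContent p.1.val + 1 ∧
          boxHeight p.2.val + 3 ≤ boxHeight p.1.val ∧
          boxHeight (σ p.1).val = boxHeight (σ p.2).val + 1 with hN₁
  set N₂ := Finset.univ.filter fun p : μ.cells × μ.cells =>
        boxContent p.2.val = boxContent p.1.val + 1 ∧
          boxHeight p.1.val + 3 ≤ boxHeight p.2.val ∧
          boxHeight (σ p.2).val = boxHeight (σ p.1).val + 1 with hN₂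
  set N₃ := Finset.univ.filter fun b : μ.cells =>
        boxContent b.val = 0 ∧ 0 < boxHeight b.val ∧ (σ b).val = (0, 0) with hN₃
  have hinj : ∀ x y : μ.cells, boxContent x.val = boxContent y.val →
      boxHeight (σ x).val = boxHeight (σ y).val → x = y := fun x y h₁ h₂ =>
    σ.injective (Subtype.ext (box_ext_of_content_height (by rw [hc, hc, h₁]) h₂))
  have hdisj : Disjoint N₁ N₂ := by
    rw [Finset.disjoint_left]
    intro e h₁ h₂
    simp only [hN₁, hN₂, Finset.mem_filter, Finset.mem_univ, true_and] at h₁ h₂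
    omega
  rcases D.eq_empty_or_nonempty with hE | hE
  · rw [hE, Finset.card_empty]
    by_contra! hlt
    have h₁ : N₁ = ∅ := Finset.card_eq_zero.1 (by omega)
    have h₂ : N₂ = ∅ := Finset.card_eq_zero.1 (by omega)
    have h₃ : N₃ = ∅ := Finset.card_eq_zero.1 (by omega)
    rw [Finset.filter_eq_empty_iff] at h₁ h₂ h₃
    exact hσ (eq_refl_of_no_jump μ σ hc
      (fun p q a b c => h₁ (Finset.mem_univ (p, q)) ⟨a, b, c⟩)
      (fun p q a b c => h₂ (Finset.mem_univ (p, q)) ⟨a, b, c⟩)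
      (fun b x y z => h₃ (Finset.mem_univ b) ⟨x, y, z⟩))
  · obtain ⟨⟨p, q⟩, hmem, hmax⟩ := D.exists_max_image (fun e => boxContent e.1.val) hE
    obtain ⟨e, he, hec⟩ : ∃ e ∈ N₁ ∪ N₂, boxContent e.2.val = boxContent p.val + 1 := by
      simp only [hD, Finset.mem_filter, Finset.mem_univ, true_and] at hmem
      obtain ⟨hpq, hlt, hh⟩ := hmem
      obtain ⟨-, s, hs, hs'⟩ := exists_square_corners μ σ hc hpq hh
      have hpar := boxHeight_parity hs
      by_cases hcase : boxHeight s.val + 3 ≤ boxHeight p.val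
      · refine ⟨(p, s), Finset.mem_union_left _ ?_, hs⟩
        simp only [hN₁, Finset.mem_filter, Finset.mem_univ, true_and]
        exact ⟨hs, hcase, by omega⟩
      · have hpar' := boxHeight_parity (hpq ▸ hs)
        refine ⟨(q, s), Finset.mem_union_right _ ?_, hs⟩
        simp only [hN₂, Finset.mem_filter, Finset.mem_univ, true_and]
        exact ⟨hpq ▸ hs, by omega, hs'⟩
    have hcard : D.card ≤ ((N₁ ∪ N₂).erase e).card := by
      refine Finset.card_le_card_of_forall_subsingleton
        (fun d e => (e.2 = d.1 ∧ boxHeight e.1.val < boxHeight e.2.val) ∨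
          (e.2 = d.2 ∧ boxHeight e.2.val < boxHeight e.1.val)) ?_ ?_
      · rintro ⟨x, y⟩ hxy
        have hle : boxContent x.val ≤ boxContent p.val := hmax _ hxy
        simp only [hD, Finset.mem_filter, Finset.mem_univ, true_and] at hxy
        obtain ⟨hpq, hlt, hh⟩ := hxy
        obtain ⟨⟨r, hr, hr'⟩, -⟩ := exists_square_corners μ σ hc hpq hh
        have hpar := boxHeight_parity hr
        have hpar' := boxHeight_parity (hpq ▸ hr)
        by_cases hcase : boxHeight r.val + 3 ≤ boxHeight x.val
        · refine ⟨(r, x), Finset.mem_erase.2 ⟨?_, Finset.mem_union_right _ ?_⟩,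
            Or.inl ⟨rfl, by dsimp only; omega⟩⟩
          · rintro rfl
            dsimp only at hec
            omega
          · simp only [hN₂, Finset.mem_filter, Finset.mem_univ, true_and]
            exact ⟨hr, hcase, by omega⟩
        · refine ⟨(r, y), Finset.mem_erase.2 ⟨?_, Finset.mem_union_left _ ?_⟩,
            Or.inr ⟨rfl, by dsimp only; omega⟩⟩
          · rintro rfl
            dsimp only at hec
            omega
          · simp only [hN₁, Finset.mem_filter, Finset.mem_univ, true_and]
            exact ⟨hpq ▸ hr, by omega, hr'⟩
      · rintro ⟨u, v⟩ - ⟨x, y⟩ ⟨hxy, hr⟩ ⟨x', y'⟩ ⟨hxy', hr'⟩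
        simp only [hD, Finset.mem_filter, Finset.mem_univ, true_and] at hxy hxy'
        obtain ⟨a, -, b⟩ := hxy
        obtain ⟨a', -, b'⟩ := hxy'
        dsimp only at hr hr'
        rcases hr with ⟨rfl, hr⟩ | ⟨rfl, hr⟩ <;> rcases hr' with ⟨rfl, hr'⟩ | ⟨rfl, hr'⟩
        · rw [hinj y y' (a.symm.trans a') (by omega)]
        · omega
        · omega
        · rw [hinj x x' (a.trans a'.symm) (by omega)]
    have hpos := Finset.card_pos.2 ⟨e, he⟩
    rw [Finset.card_erase_of_mem he] at hcard
    rw [Finset.card_union_of_disjoint hdisj] at hcard hpos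
    omega
end

section
/- Let λ be a Young diagram and k ∈ λ a box. Define the integer B(k) = [c_k > 0] − #{b ∈ λ : c_b = c_k − 1, h_b < h_k} + #{b ∈ λ : c_b = c_k + 1, h_b > h_k} − #{b ∈ λ : c_b = c_k, h_b > h_k} + #{b ∈ λ : c_b = c_k, h_b < h_k}, where [c_k > 0] is 1 if c_k > 0 and 0 otherwise. Then B(k) = β_λ(k), where β_λ(k) = 1 if either (c_k ≥ 0 and d_{c_k+1}(λ) = d_{c_k}(λ)) or (c_k < 0 and d_{c_k+1}(λ) = d_{c_k}(λ) + 1), and β_λ(k) = 0 otherwise. In particular B(k) ∈ {0,1} and B(k) depends only on the content c_k of the box (equivalently, only on whether the boundary of the Young diagram above the box increases / has a local minimum, or decreases / has a local maximum). -/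
/-- `d_k(λ)`: the number of boxes of `λ` with content `k`. -/
def dCount (μ : YoungDiagram) (k : ℤ) : ℕ :=
  (μ.cells.filter fun b => boxContent b = k).card

/-- `β_λ(□) ∈ {0,1}`: equal to `1` iff `(c_□ ≥ 0 and d_{c+1}(λ) = d_c(λ))` or
`(c_□ < 0 and d_{c+1}(λ) = d_c(λ) + 1)` — i.e. the boundary of the Young diagram above
the box increases or has a local minimum — and `0` otherwise. -/
def betaFun (μ : YoungDiagram) (b : ℕ × ℕ) : ℕ :=
  if (0 ≤ boxContent b ∧ dCount μ (boxContent b + 1) = dCount μ (boxContent b)) ∨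
      (boxContent b < 0 ∧ dCount μ (boxContent b + 1) = dCount μ (boxContent b) + 1)
  then 1 else 0

/-- The exponent `B(k) = [c_k > 0] − #{b : c_b = c_k − 1, h_b < h_k}
+ #{b : c_b = c_k + 1, h_b > h_k} − #{b : c_b = c_k, h_b > h_k}
+ #{b : c_b = c_k, h_b < h_k}`. -/
def Bexp (μ : YoungDiagram) (k : ℕ × ℕ) : ℤ :=
  (if 0 < boxContent k then 1 else 0)
    - ((μ.cells.filter fun b =>
        boxContent b = boxContent k - 1 ∧ boxHeight b < boxHeight k).card : ℤ)
    + ((μ.cells.filter fun b =>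
        boxContent b = boxContent k + 1 ∧ boxHeight k < boxHeight b).card : ℤ)
    - ((μ.cells.filter fun b =>
        boxContent b = boxContent k ∧ boxHeight k < boxHeight b).card : ℤ)
    + ((μ.cells.filter fun b =>
        boxContent b = boxContent k ∧ boxHeight b < boxHeight k).card : ℤ)

theorem exists_diagonal_mem_iff_lt (μ : YoungDiagram) (c : ℤ) :
    ∃ d : ℕ, ∀ t : ℕ, (c.toNat + t, (-c).toNat + t) ∈ μ ↔ t < d := by
  classical
  have hex : ∃ t : ℕ, (c.toNat + t, (-c).toNat + t) ∉ μ := by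
    refine ⟨μ.colLen 0, fun h => ?_⟩
    have h0 := YoungDiagram.mem_iff_lt_colLen.1 (μ.up_left_mem le_rfl (Nat.zero_le _) h)
    omega
  refine ⟨Nat.find hex, fun t => ⟨fun h => ?_, fun h => not_not.1 (Nat.find_min hex h)⟩⟩
  by_contra! hle
  exact Nat.find_spec hex (μ.up_left_mem (by omega) (by omega) h)

/-- Boxes of a fixed content are parametrized by an initial segment of the diagonal. -/
theorem card_filter_boxContent_eq {μ : YoungDiagram} {c : ℤ} {d : ℕ}
    (hd : ∀ t : ℕ, (c.toNat + t, (-c).toNat + t) ∈ μ ↔ t < d)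
    (p : ℕ → Prop) [DecidablePred p] :
    (μ.cells.filter fun b => boxContent b = c ∧ p (boxHeight b)).card =
      ((Finset.range d).filter fun t => p (c.natAbs + 2 * t)).card := by
  symm
  have hh (t : ℕ) : boxHeight (c.toNat + t, (-c).toNat + t) = c.natAbs + 2 * t := by
    simp only [boxHeight]; omega
  refine Finset.card_bij (fun t _ => (c.toNat + t, (-c).toNat + t)) ?_ ?_ ?_
  · intro t ht
    simp only [Finset.mem_filter, Finset.mem_range, YoungDiagram.mem_cells] at ht ⊢
    refine ⟨(hd t).2 ht.1, ?_, ?_⟩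
    · simp only [boxContent]; omega
    · rw [hh]; exact ht.2
  · intro s _ t _ h
    simp only [Prod.mk.injEq] at h
    omega
  · rintro ⟨i, j⟩ hb
    simp only [Finset.mem_filter, YoungDiagram.mem_cells] at hb
    obtain ⟨hm, hc, hp⟩ := hb
    have hij : (c.toNat + min i j, (-c).toNat + min i j) = (i, j) := by
      simp only [boxContent] at hc
      ext <;> simp only <;> omega
    refine ⟨min i j, ?_, hij⟩
    rw [Finset.mem_filter, Finset.mem_range, ← hd, ← hh, hij]
    exact ⟨hm, hp⟩

theorem diagonal_mem_iff_lt_dCount (μ : YoungDiagram) (c : ℤ) (t : ℕ) :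
    (c.toNat + t, (-c).toNat + t) ∈ μ ↔ t < dCount μ c := by
  obtain ⟨d, hd⟩ := exists_diagonal_mem_iff_lt μ c
  have h := card_filter_boxContent_eq hd fun _ => True
  simp only [and_true, Finset.filter_true, Finset.card_range] at h
  rw [hd, dCount, h]

theorem mem_iff_min_lt_dCount (μ : YoungDiagram) (i j : ℕ) :
    (i, j) ∈ μ ↔ min i j < dCount μ (i - j) := by
  rw [← diagonal_mem_iff_lt_dCount]
  have h : (((i : ℤ) - j).toNat + min i j, (-((i : ℤ) - j)).toNat + min i j) = (i, j) := by
    ext <;> simp only <;> omega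
  rw [h]

theorem card_filter_boxHeight_lt (μ : YoungDiagram) (c : ℤ) (h : ℕ) :
    (μ.cells.filter fun b => boxContent b = c ∧ boxHeight b < h).card =
      min (dCount μ c) ((h + 1 - c.natAbs) / 2) := by
  rw [card_filter_boxContent_eq (diagonal_mem_iff_lt_dCount μ c) (· < h),
    ← Finset.card_range (min _ _)]
  congr 1
  ext t
  simp only [Finset.mem_filter, Finset.mem_range]
  omega

theorem card_filter_lt_boxHeight (μ : YoungDiagram) (c : ℤ) (h : ℕ) :
    (μ.cells.filter fun b => boxContent b = c ∧ h < boxHeight b).card =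
      dCount μ c - (h + 2 - c.natAbs) / 2 := by
  rw [card_filter_boxContent_eq (diagonal_mem_iff_lt_dCount μ c) (h < ·), ← Nat.card_Ico]
  congr 1
  ext t
  simp only [Finset.mem_filter, Finset.mem_range, Finset.mem_Ico]
  omega

theorem dCount_add_one_of_nonneg (μ : YoungDiagram) {c : ℤ} (hc : 0 ≤ c) :
    dCount μ (c + 1) ≤ dCount μ c ∧ dCount μ c ≤ dCount μ (c + 1) + 1 := by
  constructor
  · refine le_of_forall_lt fun t ht => ?_
    rw [← diagonal_mem_iff_lt_dCount] at ht ⊢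
    exact μ.up_left_mem (by omega) (by omega) ht
  · by_contra! hlt
    have ht := (diagonal_mem_iff_lt_dCount μ c _).2 hlt
    exact lt_irrefl _ ((diagonal_mem_iff_lt_dCount μ (c + 1) (dCount μ (c + 1))).1
      (μ.up_left_mem (by omega) (by omega) ht))

theorem dCount_add_one_of_neg (μ : YoungDiagram) {c : ℤ} (hc : c < 0) :
    dCount μ c ≤ dCount μ (c + 1) ∧ dCount μ (c + 1) ≤ dCount μ c + 1 := by
  constructor
  · refine le_of_forall_lt fun t ht => ?_
    rw [← diagonal_mem_iff_lt_dCount] at ht ⊢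
    exact μ.up_left_mem (by omega) (by omega) ht
  · by_contra! hlt
    have ht := (diagonal_mem_iff_lt_dCount μ (c + 1) _).2 hlt
    exact lt_irrefl _ ((diagonal_mem_iff_lt_dCount μ c (dCount μ c)).1
      (μ.up_left_mem (by omega) (by omega) ht))

/-- For every box `k` of a Young diagram `λ`, `B(k) = β_λ(k)`; in particular
`B(k) ∈ {0,1}` and `B(k)` depends only on the content of the box. -/
theorem Bexp_eq_betaFun (μ : YoungDiagram) (k : ℕ × ℕ) (hk : k ∈ μ.cells) :
    Bexp μ k = (betaFun μ k : ℤ) := by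
  obtain ⟨i, j⟩ := k
  rw [YoungDiagram.mem_cells] at hk
  have h_succ : (i + j + 2 - ((i : ℤ) - j + 1).natAbs) / 2 = min (i + 1) j := by omega
  have h_above : (i + j + 2 - ((i : ℤ) - j).natAbs) / 2 = min i j + 1 := by omega
  have hmid := (mem_iff_min_lt_dCount μ i j).1 hk
  have h_below : min (dCount μ ((i : ℤ) - j)) ((i + j + 1 - ((i : ℤ) - j).natAbs) / 2) =
      min i j := by
    clear h_succ h_above
    omega
  have hleft : 0 < i → min (i - 1) j < dCount μ ((i : ℤ) - j - 1) := fun hi => by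
    have h := (mem_iff_min_lt_dCount μ (i - 1) j).1 (μ.up_left_mem (Nat.sub_le _ _) le_rfl hk)
    rwa [show ((i - 1 : ℕ) : ℤ) - j = (i : ℤ) - j - 1 by omega] at h
  have h_pred : min (dCount μ ((i : ℤ) - j - 1)) ((i + j + 1 - ((i : ℤ) - j - 1).natAbs) / 2) =
      min i (j + 1) := by
    clear hmid h_succ h_above h_below
    omega
  have hdown : 0 < j → min i (j - 1) < dCount μ ((i : ℤ) - j + 1) := fun hj => by
    have h := (mem_iff_min_lt_dCount μ i (j - 1)).1 (μ.up_left_mem le_rfl (Nat.sub_le _ _) hk)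
    rwa [show (i : ℤ) - ((j - 1 : ℕ) : ℤ) = (i : ℤ) - j + 1 by omega] at h
  have hnonneg := @dCount_add_one_of_nonneg μ ((i : ℤ) - j)
  have hneg := @dCount_add_one_of_neg μ ((i : ℤ) - j)
  rw [Bexp, betaFun]
  simp only [card_filter_boxHeight_lt, card_filter_lt_boxHeight]
  have h_height : boxHeight (i, j) = i + j := rfl
  rw [h_height]
  generalize hc : boxContent (i, j) = c
  change (i : ℤ) - j = c at hc
  rw [hc] at h_succ h_above hmid h_below h_pred hdown hnonneg hneg
  rw [h_pred, h_succ, h_above, h_below]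
  clear h_pred h_succ h_above h_below hleft
  rcases lt_or_ge i j with h | h
  · have hd := hneg (by omega)
    clear hneg hnonneg
    rw [min_eq_left h.le] at *
    rw [min_eq_left (by omega : i ≤ j + 1), min_eq_left (by omega : i + 1 ≤ j)]
    split_ifs <;> omega
  · have hd := hnonneg (by omega)
    clear hneg hnonneg
    rw [min_eq_right h] at *
    rw [min_eq_right (by omega : j ≤ i + 1)]
    split_ifs <;> omega
end
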